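/- F is twice differentiable at η and F(η) times its second Fréchet derivative at η equals τ times the angular metric of the base: for all X, Y ∈ V, L*·(fderiv (y ↦ fderiv F y) at η)(X)(Y) = τ(⟪X,Y⟫ − ℓ(X)ℓ(Y)). (The content of the second line of equation (5) of the paper, h* = τh, for a Randers structure over a Riemannian (inner product) base.) -/

import Mathlib

open scoped RealInnerProductSpace

theorem randers_aux_norm {V : Type*} [NormedAddCommGroup V] [InnerProductSpace ℝ V]
    (y : V) (hy : y ≠ 0) : HasFDerivAt (fun z : V => ‖z‖) (‖y‖⁻¹ • innerSL ℝ y) y := by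
  have hn : ‖y‖ ≠ 0 := norm_ne_zero_iff.mpr hy
  have h1 := (hasStrictFDerivAt_norm_sq y).hasFDerivAt.sqrt (pow_ne_zero 2 hn)
  simp only [Real.sqrt_sq (norm_nonneg _)] at h1
  refine h1.congr_fderiv ?_
  ext z
  simp
  field_simp

theorem randers_aux_F {V : Type*} [NormedAddCommGroup V] [InnerProductSpace ℝ V]
    (b y : V) (hy : y ≠ 0) : HasFDerivAt (fun z : V => ‖z‖ + ⟪b, z⟫)
      (‖y‖⁻¹ • innerSL ℝ y + innerSL ℝ b) y :=
  (randers_aux_norm y hy).add (innerSL ℝ b).hasFDerivAt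

/-- For the Randers function `F(y) = ‖y‖ + ⟪b,y⟫` with `L* = F(η) > 0`, `F` is
twice differentiable at `η` and `F(η)` times its second Fréchet derivative at
`η` is `τ` times the angular metric of the base: for all `X, Y`,
`L*·(fderiv (y ↦ fderiv F y) η)(X)(Y) = τ(⟪X,Y⟫ - ℓ(X)ℓ(Y))`, where `L = ‖η‖`,
`τ = L*/L`, `ℓ(X) = ⟪X,η⟫/L`. -/
theorem randers_angular_metric {V : Type*} [NormedAddCommGroup V] [InnerProductSpace ℝ V]
    (b η : V) (hη : η ≠ 0) (hLstar : 0 < ‖η‖ + ⟪b, η⟫) :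
    DifferentiableAt ℝ (fun y : V => ‖y‖ + ⟪b, y⟫) η ∧
    DifferentiableAt ℝ (fun y : V => fderiv ℝ (fun z : V => ‖z‖ + ⟪b, z⟫) y) η ∧
      ∀ X Y : V,
        (‖η‖ + ⟪b, η⟫) * fderiv ℝ (fun y : V => fderiv ℝ (fun z : V => ‖z‖ + ⟪b, z⟫) y) η X Y
          = ((‖η‖ + ⟪b, η⟫) / ‖η‖) * (⟪X, Y⟫ - (⟪X, η⟫ / ‖η‖) * (⟪Y, η⟫ / ‖η‖)) := by
  have hn : ‖η‖ ≠ 0 := norm_ne_zero_iff.mpr hη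
  have hinv : HasFDerivAt (fun y : V => ‖y‖⁻¹) (-(‖η‖ ^ 2)⁻¹ • (‖η‖⁻¹ • innerSL ℝ η)) η :=
    (hasDerivAt_inv hn).comp_hasFDerivAt η (randers_aux_norm η hη)
  have hG := (hinv.smul (innerSL ℝ (E := V)).hasFDerivAt).add_const (innerSL ℝ b)
  have hev : (fun y : V => fderiv ℝ (fun z : V => ‖z‖ + ⟪b, z⟫) y) =ᶠ[nhds η]
      (fun y : V => ‖y‖⁻¹ • innerSL ℝ y + innerSL ℝ b) := by
    filter_upwards [isOpen_ne.mem_nhds hη] with y hy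
    exact (randers_aux_F b y hy).fderiv
  have hF := hG.congr_of_eventuallyEq hev
  refine ⟨(randers_aux_F b η hη).differentiableAt, hF.differentiableAt, fun X Y => ?_⟩
  rw [hF.fderiv]
  simp [real_inner_comm η X, real_inner_comm η Y]
  field_simp
  rfl
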